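/- Let (X_n)_{n≥0} be an excited asymmetric random walk with M cookies, cookie strength vector p ∈ (0,1)^M and bias parameter p_0 ∈ (0,1), and suppose that T_n < ∞ almost surely for every n ≥ 0 (i.e., the walk is recurrent or transient to the right). Let (Z_n)_{n≥0} be the backwards branching-like process associated to (M, p, p_0) started at Z_0 = 0. Then for every n ∈ ℕ, the random vector (U_n^n, U_{n−1}^n, …, U_0^n) has the same joint distribution as (Z_0, Z_1, …, Z_n). -/

import Mathlib

open MeasureTheory ProbabilityTheory Filter Topology

/-- The success probability of the `j+1`-st visit to a site: `p (j+1)` while cookies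
remain (`j < M`), and the bias parameter `p₀` afterwards. -/
noncomputable def cookieSeq (M : ℕ) (p : Fin M → ℝ) (p₀ : ℝ) (j : ℕ) : ℝ :=
  if h : j < M then p ⟨j, h⟩ else p₀

/-- `IsEARW P M p p₀ X` : under the probability measure `P`, the process `X` is an
excited asymmetric random walk with `M` cookies of strengths `p ∈ (0,1)^M` and bias
parameter `p₀`: it starts at `0`, moves by `±1` steps, and conditionally on the path
`(X 0, …, X n)` it steps right with probability `p i` on the event
`#{m ≤ n : X m = X n} = i` for `1 ≤ i ≤ M`, and with probability `p₀` on the event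
`#{m ≤ n : X m = X n} > M`. -/
structure IsEARW {Ω : Type*} [MeasurableSpace Ω] (P : Measure Ω)
    (M : ℕ) (p : Fin M → ℝ) (p₀ : ℝ) (X : ℕ → Ω → ℤ) : Prop where
  measurable : ∀ n, Measurable (X n)
  init : ∀ ω, X 0 ω = 0
  steps : ∀ ω n, |X (n + 1) ω - X n ω| = 1
  cond : ∀ (n : ℕ) (w : Fin (n + 1) → ℤ),
    P ({ω | X (n + 1) ω = w (Fin.last n) + 1} ∩ {ω | ∀ m : Fin (n + 1), X m ω = w m})
      = ENNReal.ofReal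
          (cookieSeq M p p₀
            ((Finset.univ.filter fun m : Fin (n + 1) => w m = w (Fin.last n)).card - 1))
        * P {ω | ∀ m : Fin (n + 1), X m ω = w m}


/-- `bbTrans q l m` is the transition probability `p(l,m) = P(A (l+1) = m)` of the
backwards branching-like process: the probability that in a sequence of independent
Bernoulli trials whose `j`-th trial succeeds with probability `q j` (`j` 0-indexed),
there are exactly `m` failures before the `(l+1)`-st success.  Equivalently, among the
first `m + l` trials there are exactly `l` successes and trial `m + l` is a success. -/
noncomputable def bbTrans (q : ℕ → ℝ) (l m : ℕ) : ℝ :=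
  (∑ s ∈ Finset.univ.filter
      (fun s : Fin (m + l) → Bool =>
        (Finset.univ.filter fun j => s j = true).card = l),
    ∏ j : Fin (m + l), (if s j then q (j : ℕ) else 1 - q (j : ℕ)))
    * q (m + l)

/-- `hitTime X n ω` is `T n = inf {t ≥ 0 : X t = n}` (junk value `0` if the walk never
hits `n`, which is a.s. irrelevant under the recurrence/transience hypothesis below). -/
noncomputable def hitTime {Ω : Type*} (X : ℕ → Ω → ℤ) (n : ℕ) (ω : Ω) : ℕ :=
  sInf {t : ℕ | X t ω = (n : ℤ)}

/-- `leftSteps X x n ω` is `U_x^n = #{t < T n : X t = x, X (t+1) = x - 1}`, the number of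
left steps from site `x` before time `T n`. -/
noncomputable def leftSteps {Ω : Type*} (X : ℕ → Ω → ℤ) (x : ℤ) (n : ℕ) (ω : Ω) : ℕ :=
  ((Finset.range (hitTime X n ω)).filter
    (fun t => X t ω = x ∧ X (t + 1) ω = x - 1)).card

/-- The probability of exactly `l` successes among the first `N` trials with success
probabilities `q 0, …, q (N - 1)`. -/
noncomputable def successProb (q : ℕ → ℝ) (N l : ℕ) : ℝ :=
  ∑ s ∈ Finset.univ.filter
      (fun s : Fin N → Bool => (Finset.univ.filter fun j => s j = true).card = l),
    ∏ j : Fin N, (if s j then q (j : ℕ) else 1 - q (j : ℕ))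

lemma bbTrans_eq_successProb (q : ℕ → ℝ) (l m : ℕ) :
    bbTrans q l m = successProb q (m + l) l * q (m + l) := rfl

lemma successProb_zero (q : ℕ → ℝ) : successProb q 0 0 = 1 := by
  simp [successProb]

lemma successProb_eq_zero_of_lt (q : ℕ → ℝ) {N l : ℕ} (h : N < l) :
    successProb q N l = 0 := by
  unfold successProb
  rw [Finset.filter_eq_empty_iff.2, Finset.sum_empty]
  intro s _ hs
  have := Finset.card_filter_le (Finset.univ : Finset (Fin N)) (fun j => s j = true)
  simp only [Finset.card_univ, Fintype.card_fin] at this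
  omega

lemma successProb_nonneg {q : ℕ → ℝ} (hq : ∀ j, q j ∈ Set.Icc (0 : ℝ) 1) (N l : ℕ) :
    0 ≤ successProb q N l := by
  refine Finset.sum_nonneg fun s _ => Finset.prod_nonneg fun j _ => ?_
  split_ifs
  · exact (hq _).1
  · linarith [(hq j).2]

lemma sum_fin_succ_bool_arrow {N : ℕ} (f : (Fin (N + 1) → Bool) → ℝ) :
    ∑ s, f s = ∑ s : Fin N → Bool, f (Fin.cons true s)
      + ∑ s : Fin N → Bool, f (Fin.cons false s) := by
  rw [← (Fin.consEquiv fun _ : Fin (N + 1) => Bool).sum_comp, Fintype.sum_prod_type]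
  simp [Fin.consEquiv]

lemma successProb_succ_succ (q : ℕ → ℝ) (N l : ℕ) :
    successProb q (N + 1) (l + 1) = q 0 * successProb (fun j => q (j + 1)) N l
      + (1 - q 0) * successProb (fun j => q (j + 1)) N (l + 1) := by
  simp only [successProb, Finset.sum_filter, sum_fin_succ_bool_arrow, Finset.mul_sum]
  congr 1 <;> refine Finset.sum_congr rfl fun s _ => ?_ <;>
    simp [Fin.card_filter_univ_succ, Fin.prod_univ_succ]

lemma successProb_succ_zero (q : ℕ → ℝ) (N : ℕ) :
    successProb q (N + 1) 0 = (1 - q 0) * successProb (fun j => q (j + 1)) N 0 := by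
  simp only [successProb, Finset.sum_filter, sum_fin_succ_bool_arrow, Finset.mul_sum]
  simp [Fin.card_filter_univ_succ, Fin.prod_univ_succ]

lemma bbTrans_zero_zero (q : ℕ → ℝ) : bbTrans q 0 0 = q 0 := by
  simp [bbTrans_eq_successProb, successProb_zero]

lemma bbTrans_succ_zero (q : ℕ → ℝ) (l : ℕ) :
    bbTrans q (l + 1) 0 = q 0 * bbTrans (fun j => q (j + 1)) l 0 := by
  simp only [bbTrans_eq_successProb, ← add_assoc, successProb_succ_succ]
  rw [successProb_eq_zero_of_lt _ (show 0 + l < l + 1 by omega)]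
  ring

lemma bbTrans_zero_succ (q : ℕ → ℝ) (m : ℕ) :
    bbTrans q 0 (m + 1) = (1 - q 0) * bbTrans (fun j => q (j + 1)) 0 m := by
  simp only [bbTrans_eq_successProb, add_zero, successProb_succ_zero]
  ring

lemma bbTrans_succ_succ (q : ℕ → ℝ) (l m : ℕ) :
    bbTrans q (l + 1) (m + 1) = q 0 * bbTrans (fun j => q (j + 1)) l (m + 1)
      + (1 - q 0) * bbTrans (fun j => q (j + 1)) (l + 1) m := by
  simp only [bbTrans_eq_successProb, ← add_assoc, successProb_succ_succ q]
  rw [show m + 1 + l = m + l + 1 by ring]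
  ring

lemma bbTrans_nonneg {q : ℕ → ℝ} (hq : ∀ j, q j ∈ Set.Icc (0 : ℝ) 1) (l m : ℕ) :
    0 ≤ bbTrans q l m :=
  mul_nonneg (successProb_nonneg hq _ _) (hq _).1

lemma bbTrans_le_one {q : ℕ → ℝ} (hq : ∀ j, q j ∈ Set.Icc (0 : ℝ) 1) (l m : ℕ) :
    bbTrans q l m ≤ 1 := by
  induction l generalizing q m with
  | zero =>
    induction m generalizing q with
    | zero => rw [bbTrans_zero_zero]; exact (hq 0).2
    | succ m ihm =>
      rw [bbTrans_zero_succ]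
      have hq' : ∀ j, q (j + 1) ∈ Set.Icc (0 : ℝ) 1 := fun j => hq (j + 1)
      exact mul_le_one₀ (by linarith [(hq 0).1]) (bbTrans_nonneg hq' _ _) (ihm hq')
  | succ l ihl =>
    induction m generalizing q with
    | zero =>
      rw [bbTrans_succ_zero]
      have hq' : ∀ j, q (j + 1) ∈ Set.Icc (0 : ℝ) 1 := fun j => hq (j + 1)
      exact mul_le_one₀ (hq 0).2 (bbTrans_nonneg hq' _ _) (ihl hq' 0)
    | succ m ihm =>
      rw [bbTrans_succ_succ]
      have hq' : ∀ j, q (j + 1) ∈ Set.Icc (0 : ℝ) 1 := fun j => hq (j + 1)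
      nlinarith [(hq 0).1, (hq 0).2, ihl hq' (m + 1), ihm hq']

/-- The conditional probability that exactly `m` failures precede the `(l+1)`-st success,
when `r` successes and `k` failures have been observed so far. Once `l + 1` successes are
observed, it is set to `1` if `k = m` and to `0` otherwise. -/
noncomputable def siteProb (q : ℕ → ℝ) (l m r k : ℕ) : ℝ :=
  if m < k then 0 else if l < r then (if k = m then 1 else 0)
    else bbTrans (fun j => q (r + k + j)) (l - r) (m - k)

lemma siteProb_zero_zero (q : ℕ → ℝ) (l m : ℕ) : siteProb q l m 0 0 = bbTrans q l m := by
  simp [siteProb]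

lemma siteProb_of_lt (q : ℕ → ℝ) (l : ℕ) {m k : ℕ} (r : ℕ) (h : m < k) :
    siteProb q l m r k = 0 := by
  simp [siteProb, h]

lemma siteProb_succ_self (q : ℕ → ℝ) (l m k : ℕ) :
    siteProb q l m (l + 1) k = if k = m then 1 else 0 := by
  unfold siteProb
  split_ifs <;> first | rfl | omega

lemma siteProb_mem_Icc {q : ℕ → ℝ} (hq : ∀ j, q j ∈ Set.Icc (0 : ℝ) 1) (l m r k : ℕ) :
    siteProb q l m r k ∈ Set.Icc (0 : ℝ) 1 := by
  unfold siteProb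
  split_ifs
  · simp
  · simp
  · simp
  · exact ⟨bbTrans_nonneg (fun j => hq _) _ _, bbTrans_le_one (fun j => hq _) _ _⟩

lemma siteProb_step (q : ℕ → ℝ) {l r : ℕ} (m k : ℕ) (h : r ≤ l) :
    siteProb q l m r k = q (r + k) * siteProb q l m (r + 1) k
      + (1 - q (r + k)) * siteProb q l m r (k + 1) := by
  obtain ⟨a, rfl⟩ := Nat.exists_eq_add_of_le h
  rcases lt_or_ge m k with hk | hk
  · simp [siteProb, hk, hk.trans (Nat.lt_succ_self k)]
  obtain ⟨b, rfl⟩ := Nat.exists_eq_add_of_le hk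
  have e1 : (fun j => q (r + k + (j + 1))) = fun j => q (r + 1 + k + j) := by
    ext j; congr 1; ring
  have e2 : (fun j => q (r + k + (j + 1))) = fun j => q (r + (k + 1) + j) := by
    ext j; congr 1; ring
  rcases a with _ | a <;> rcases b with _ | b
  · simp [siteProb, bbTrans_zero_zero]
  · have h1 : ¬ k + (b + 1) < k := by omega
    have h2 : ¬ k + (b + 1) < k + 1 := by omega
    simp only [siteProb, h1, h2, if_false, add_zero, lt_irrefl, Nat.lt_succ_self, if_true,
      Nat.sub_self]
    rw [show k + (b + 1) - k = b + 1 by omega, show k + (b + 1) - (k + 1) = b by omega,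
      bbTrans_zero_succ, e2]
    simp
  · have h1 : ¬ r + (a + 1) < r := by omega
    have h2 : ¬ r + (a + 1) < r + 1 := by omega
    simp only [siteProb, h1, h2, if_false, add_zero, lt_irrefl, Nat.lt_succ_self, if_true,
      Nat.sub_self]
    rw [show r + (a + 1) - r = a + 1 by omega, show r + (a + 1) - (r + 1) = a by omega,
      bbTrans_succ_zero, e1]
    simp
  · have h1 : ¬ r + (a + 1) < r := by omega
    have h2 : ¬ r + (a + 1) < r + 1 := by omega
    have h3 : ¬ k + (b + 1) < k := by omega
    have h4 : ¬ k + (b + 1) < k + 1 := by omega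
    simp only [siteProb, h1, h2, h3, h4, if_false]
    rw [show r + (a + 1) - r = a + 1 by omega, show r + (a + 1) - (r + 1) = a by omega,
      show k + (b + 1) - k = b + 1 by omega, show k + (b + 1) - (k + 1) = b by omega,
      bbTrans_succ_succ]
    simp only [add_zero]
    rw [← e1, ← e2]

/-- The product over the sites `n - 1, …, 0` of the conditional probabilities `siteProb`, where
`r y` right steps and `k y` left steps from each site `y` have been observed. -/
noncomputable def countPotential (q : ℕ → ℝ) {n : ℕ} (z : Fin (n + 1) → ℕ) (r k : ℤ → ℕ) : ℝ :=
  ∏ i : Fin n, siteProb q (z i.castSucc) (z i.succ)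
    (r ((n : ℤ) - 1 - (i : ℕ))) (k ((n : ℤ) - 1 - (i : ℕ)))

lemma countPotential_mem_Icc {q : ℕ → ℝ} (hq : ∀ j, q j ∈ Set.Icc (0 : ℝ) 1) {n : ℕ}
    (z : Fin (n + 1) → ℕ) (r k : ℤ → ℕ) : countPotential q z r k ∈ Set.Icc (0 : ℝ) 1 :=
  ⟨Finset.prod_nonneg fun _ _ => (siteProb_mem_Icc hq _ _ _ _).1,
    Finset.prod_le_one (fun _ _ => (siteProb_mem_Icc hq _ _ _ _).1)
      fun _ _ => (siteProb_mem_Icc hq _ _ _ _).2⟩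

lemma countPotential_eq_zero_of_lt (q : ℕ → ℝ) {n : ℕ} (z : Fin (n + 1) → ℕ) (r k : ℤ → ℕ)
    (i : Fin n) (h : z i.succ < k ((n : ℤ) - 1 - (i : ℕ))) : countPotential q z r k = 0 :=
  Finset.prod_eq_zero (Finset.mem_univ i) (siteProb_of_lt _ _ _ h)

/-- The potential is harmonic for a step from the site `y`. -/
lemma countPotential_step (q : ℕ → ℝ) {n : ℕ} (z : Fin (n + 1) → ℕ) (r k : ℤ → ℕ) {y : ℤ}
    (hy : y < n) (hk : k n = 0) (hyr : 0 ≤ y → r y = k (y + 1)) :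
    countPotential q z r k
      = q (r y + k y) * countPotential q z (Function.update r y (r y + 1)) k
        + (1 - q (r y + k y)) * countPotential q z r (Function.update k y (k y + 1)) := by
  rcases lt_or_ge y 0 with hy0 | hy0
  · have hne : ∀ i : Fin n, (n : ℤ) - 1 - (i : ℕ) ≠ y := fun i => by have := i.2; omega
    simp only [countPotential, Function.update_of_ne (hne _)]
    ring
  obtain ⟨j, hj⟩ : ∃ j : Fin n, (n : ℤ) - 1 - (j : ℕ) = y :=
    ⟨⟨(n - 1 - y).toNat, by omega⟩, by simp only; omega⟩
  have hne : ∀ i ∈ Finset.univ.erase j, (n : ℤ) - 1 - (i : ℕ) ≠ y := fun i hi h => by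
    refine (Finset.mem_erase.1 hi).1 (Fin.ext ?_)
    omega
  rcases le_or_gt (r y) (z j.castSucc) with hr | hr
  · simp only [countPotential]
    rw [← Finset.mul_prod_erase _ _ (Finset.mem_univ j),
      ← Finset.mul_prod_erase _ _ (Finset.mem_univ j),
      ← Finset.mul_prod_erase _ _ (Finset.mem_univ j)]
    rw [Finset.prod_congr rfl (fun i hi => by rw [Function.update_of_ne (hne i hi)] :
        ∀ i ∈ Finset.univ.erase j, siteProb q (z i.castSucc) (z i.succ)
            (Function.update r y (r y + 1) ((n : ℤ) - 1 - (i : ℕ))) (k ((n : ℤ) - 1 - (i : ℕ)))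
          = siteProb q (z i.castSucc) (z i.succ)
            (r ((n : ℤ) - 1 - (i : ℕ))) (k ((n : ℤ) - 1 - (i : ℕ)))),
      Finset.prod_congr rfl (fun i hi => by rw [Function.update_of_ne (hne i hi)] :
        ∀ i ∈ Finset.univ.erase j, siteProb q (z i.castSucc) (z i.succ)
            (r ((n : ℤ) - 1 - (i : ℕ))) (Function.update k y (k y + 1) ((n : ℤ) - 1 - (i : ℕ)))
          = siteProb q (z i.castSucc) (z i.succ)
            (r ((n : ℤ) - 1 - (i : ℕ))) (k ((n : ℤ) - 1 - (i : ℕ))))]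
    rw [hj, Function.update_self, Function.update_self, siteProb_step q _ _ hr]
    ring
  · have hr' := hr
    rw [hyr hy0] at hr'
    have hj0 : (j : ℕ) ≠ 0 := by
      intro h0
      rw [show y + 1 = n by omega, hk] at hr'
      omega
    have hjn := j.2
    let i : Fin n := ⟨j - 1, by omega⟩
    have hi : (n : ℤ) - 1 - (i : ℕ) = y + 1 := by simp only [i]; omega
    have hzi : i.succ = j.castSucc := Fin.ext (by simp [i]; omega)
    rw [countPotential_eq_zero_of_lt q z r k i (by rwa [hi, hzi]),
      countPotential_eq_zero_of_lt q z _ k i (by rwa [hi, hzi]),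
      countPotential_eq_zero_of_lt q z r _ i
        (by rwa [hi, hzi, Function.update_of_ne (by omega)])]
    ring

/-- The number of steps from `y` to `y + d` that the path `x` makes before time `t`. -/
def stepCount (x : ℕ → ℤ) (d : ℤ) (t : ℕ) (y : ℤ) : ℕ :=
  ((Finset.range t).filter fun s => x s = y ∧ x (s + 1) = y + d).card

lemma stepCount_zero (x : ℕ → ℤ) (d y : ℤ) : stepCount x d 0 y = 0 := by simp [stepCount]

lemma stepCount_succ (x : ℕ → ℤ) (d : ℤ) (t : ℕ) (y : ℤ) :
    stepCount x d (t + 1) y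
      = stepCount x d t y + if x t = y ∧ x (t + 1) = y + d then 1 else 0 := by
  simp only [stepCount, Finset.card_filter, Finset.sum_range_succ]

lemma stepCount_succ_of_eq {x : ℕ → ℤ} {d : ℤ} {t : ℕ} (h : x (t + 1) = x t + d) :
    stepCount x d (t + 1)
      = Function.update (stepCount x d t) (x t) (stepCount x d t (x t) + 1) := by
  ext y
  rcases eq_or_ne y (x t) with rfl | hy
  · simp [stepCount_succ, h]
  · simp [stepCount_succ, hy, hy.symm]

lemma stepCount_succ_of_ne {x : ℕ → ℤ} {d : ℤ} {t : ℕ} (h : x (t + 1) ≠ x t + d) :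
    stepCount x d (t + 1) = stepCount x d t := by
  ext y
  rw [stepCount_succ, if_neg, add_zero]
  rintro ⟨rfl, h'⟩
  exact h h'

lemma stepCount_congr {x x' : ℕ → ℤ} {t : ℕ} (h : ∀ s ≤ t, x s = x' s) (d : ℤ) :
    stepCount x d t = stepCount x' d t := by
  ext y
  unfold stepCount
  congr 1
  refine Finset.filter_congr fun s hs => ?_
  rw [Finset.mem_range] at hs
  rw [h s (by omega), h (s + 1) (by omega)]

lemma stepCount_eq_zero_of_forall_ne {x : ℕ → ℤ} {t : ℕ} {y : ℤ} (h : ∀ s < t, x s ≠ y) (d : ℤ) :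
    stepCount x d t y = 0 := by
  rw [stepCount, Finset.card_eq_zero, Finset.filter_eq_empty_iff]
  intro s hs hsy
  exact h s (Finset.mem_range.1 hs) hsy.1

/-- The up-crossings of the edge `{y, y + 1}` exceed the down-crossings by one if the path is
above the edge, and the two numbers agree otherwise. -/
lemma stepCount_edge {x : ℕ → ℤ} (h0 : x 0 = 0) (hs : ∀ t, |x (t + 1) - x t| = 1) {y : ℤ}
    (hy : 0 ≤ y) (t : ℕ) :
    stepCount x 1 t y = stepCount x (-1) t (y + 1) + if y < x t then 1 else 0 := by
  induction t with
  | zero => simp [stepCount_zero, h0, hy]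
  | succ t ih =>
    rw [stepCount_succ, stepCount_succ, ih]
    have := hs t
    rcases (abs_eq zero_le_one).1 this with h | h <;> split_ifs <;> omega

lemma card_visits_sub_one {x : ℕ → ℤ} (hs : ∀ t, |x (t + 1) - x t| = 1) (t : ℕ) :
    (Finset.univ.filter fun m : Fin (t + 1) => x m = x t).card - 1
      = stepCount x 1 t (x t) + stepCount x (-1) t (x t) := by
  have key : ∀ y, stepCount x 1 t y + stepCount x (-1) t y
      = ∑ s ∈ Finset.range t, if x s = y then 1 else 0 := by
    intro y
    simp only [stepCount, Finset.card_filter, ← Finset.sum_add_distrib]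
    refine Finset.sum_congr rfl fun s _ => ?_
    rcases (abs_eq zero_le_one).1 (hs s) with h | h <;> split_ifs <;> omega
  rw [key, Finset.card_filter,
    Fin.sum_univ_eq_sum_range (fun m => if x m = x t then 1 else 0) (t + 1),
    Finset.sum_range_succ]
  simp

/-- The potential of the path `x` at time `t`, stopped when the path hits `n`. -/
noncomputable def stoppedPotential (q : ℕ → ℝ) {n : ℕ} (z : Fin (n + 1) → ℕ) (x : ℕ → ℤ) : ℕ → ℝ
  | 0 => countPotential q z (stepCount x 1 0) (stepCount x (-1) 0)
  | t + 1 =>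
    open Classical in
    if ∃ s ≤ t, x s = n then stoppedPotential q z x t
    else countPotential q z (stepCount x 1 (t + 1)) (stepCount x (-1) (t + 1))

section StoppedPotential

variable {q : ℕ → ℝ} {n : ℕ} {z : Fin (n + 1) → ℕ} {x : ℕ → ℤ}

lemma stoppedPotential_zero : stoppedPotential q z x 0 = ∏ i : Fin n,
    bbTrans q (z i.castSucc) (z i.succ) := by
  simp [stoppedPotential, countPotential, stepCount_zero, siteProb_zero_zero]

lemma stoppedPotential_of_forall_ne {t : ℕ} (h : ∀ s < t, x s ≠ n) :
    stoppedPotential q z x t = countPotential q z (stepCount x 1 t) (stepCount x (-1) t) := by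
  cases t with
  | zero => rfl
  | succ t =>
    rw [stoppedPotential, if_neg]
    rintro ⟨s, hs, hn⟩
    exact h s (by omega) hn

lemma stoppedPotential_succ_of_exists {t : ℕ} (h : ∃ s ≤ t, x s = n) :
    stoppedPotential q z x (t + 1) = stoppedPotential q z x t := by
  rw [stoppedPotential, if_pos h]

lemma stoppedPotential_of_ge {T t : ℕ} (hT : x T = n) (h : T ≤ t) :
    stoppedPotential q z x t = stoppedPotential q z x T := by
  induction t, h using Nat.le_induction with
  | base => rfl
  | succ t h ih => rw [stoppedPotential_succ_of_exists ⟨T, h, hT⟩, ih]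

lemma stoppedPotential_congr {x' : ℕ → ℤ} {t : ℕ} (h : ∀ s ≤ t, x s = x' s) :
    stoppedPotential q z x t = stoppedPotential q z x' t := by
  induction t with
  | zero => simp only [stoppedPotential_zero]
  | succ t ih =>
    have : (∃ s ≤ t, x s = n) ↔ ∃ s ≤ t, x' s = n :=
      exists_congr fun s => and_congr_right fun hs => by rw [h s (by omega)]
    simp only [stoppedPotential, this, stepCount_congr h, ih fun s hs => h s (by omega)]

lemma stoppedPotential_mem_Icc (hq : ∀ j, q j ∈ Set.Icc (0 : ℝ) 1) (t : ℕ) :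
    stoppedPotential q z x t ∈ Set.Icc (0 : ℝ) 1 := by
  induction t with
  | zero => exact countPotential_mem_Icc hq _ _ _
  | succ t ih =>
    rw [stoppedPotential]
    split_ifs
    · exact ih
    · exact countPotential_mem_Icc hq _ _ _

lemma forall_lt_of_forall_ne (h0 : x 0 = 0) (hs : ∀ t, |x (t + 1) - x t| = 1) {t : ℕ}
    (h : ∀ s ≤ t, x s ≠ n) : x t < n := by
  induction t with
  | zero => have := h 0 le_rfl; rw [h0] at this ⊢; omega
  | succ t ih =>
    have h1 := ih fun s hs => h s (by omega)
    have h2 := h (t + 1) le_rfl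
    rcases (abs_eq zero_le_one).1 (hs t) with h | h <;> omega

lemma countPotential_at_hit (hz : z 0 = 0) (h0 : x 0 = 0) (hs : ∀ t, |x (t + 1) - x t| = 1)
    {T : ℕ} (hT : x T = n) (hlt : ∀ s < T, x s ≠ n)
    [Decidable (∀ i : Fin (n + 1), stepCount x (-1) T ((n : ℤ) - (i : ℕ)) = z i)] :
    countPotential q z (stepCount x 1 T) (stepCount x (-1) T)
      = if ∀ i : Fin (n + 1), stepCount x (-1) T ((n : ℤ) - (i : ℕ)) = z i then 1 else 0 := by
  have hn0 : stepCount x (-1) T n = 0 := stepCount_eq_zero_of_forall_ne hlt _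
  have hedge : ∀ i : Fin n, stepCount x 1 T ((n : ℤ) - 1 - (i : ℕ))
      = stepCount x (-1) T ((n : ℤ) - (i.castSucc : ℕ)) + 1 := fun i => by
    have := i.2
    rw [stepCount_edge h0 hs (by omega), if_pos (by omega)]
    congr 2
    simp only [Fin.val_castSucc]
    ring
  have hsucc : ∀ i : Fin n, (n : ℤ) - 1 - (i : ℕ) = (n : ℤ) - (i.succ : ℕ) := fun i => by
    simp only [Fin.val_succ]; push_cast; ring
  split_ifs with h
  · refine Finset.prod_eq_one fun i _ => ?_
    rw [hedge, h, siteProb_succ_self, hsucc, h, if_pos rfl]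
  · by_contra hne
    refine h fun i => ?_
    induction i using Fin.induction with
    | zero => simpa [hz] using hn0
    | succ i ih =>
      by_contra hi
      refine hne (Finset.prod_eq_zero (Finset.mem_univ i) ?_)
      rw [hedge, ih, siteProb_succ_self, hsucc, if_neg hi]

end StoppedPotential

lemma cookieSeq_mem_Icc {M : ℕ} {p : Fin M → ℝ} (hp : ∀ i, p i ∈ Set.Ioo (0 : ℝ) 1) {p₀ : ℝ}
    (hp₀ : p₀ ∈ Set.Ioo (0 : ℝ) 1) (j : ℕ) : cookieSeq M p p₀ j ∈ Set.Icc (0 : ℝ) 1 := by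
  unfold cookieSeq
  split_ifs
  · exact Set.Ioo_subset_Icc_self (hp _)
  · exact Set.Ioo_subset_Icc_self hp₀

section Martingale

variable {Ω : Type*} [MeasurableSpace Ω] {P : Measure Ω} {X : ℕ → Ω → ℤ} {q : ℕ → ℝ} {n : ℕ}
  {z : Fin (n + 1) → ℕ}

lemma measurable_stoppedPotential (hX : ∀ n, Measurable (X n)) (t : ℕ) :
    Measurable fun ω => stoppedPotential q z (fun s => X s ω) t := by
  let extend : (Fin (t + 1) → ℤ) → ℕ → ℤ := fun w s => if h : s < t + 1 then w ⟨s, h⟩ else 0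
  have h : (fun ω => stoppedPotential q z (fun s => X s ω) t)
      = (fun w => stoppedPotential q z (extend w) t) ∘ fun ω (m : Fin (t + 1)) => X m ω := by
    ext ω
    refine stoppedPotential_congr fun s hs => ?_
    simp [extend, hs.not_gt]
  rw [h]
  exact (measurable_of_countable _).comp (measurable_pi_lambda _ fun m => hX m)

lemma measurableSet_forall_eq (hX : ∀ n, Measurable (X n)) {t : ℕ} (w : Fin (t + 1) → ℤ) :
    MeasurableSet {ω | ∀ m : Fin (t + 1), X m ω = w m} := by
  rw [Set.ofPred_forall]
  exact MeasurableSet.iInter fun m => hX m (measurableSet_singleton (w m))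

variable {M : ℕ} {p : Fin M → ℝ} {p₀ : ℝ}

lemma setLIntegral_stoppedPotential_succ [IsProbabilityMeasure P]
    (hq : ∀ j, cookieSeq M p p₀ j ∈ Set.Icc (0 : ℝ) 1) (hX : IsEARW P M p p₀ X) (t : ℕ)
    (w : Fin (t + 1) → ℤ) :
    ∫⁻ ω in {ω | ∀ m : Fin (t + 1), X m ω = w m},
        ENNReal.ofReal (stoppedPotential (cookieSeq M p p₀) z (fun s => X s ω) (t + 1)) ∂P
      = ∫⁻ ω in {ω | ∀ m : Fin (t + 1), X m ω = w m},
        ENNReal.ofReal (stoppedPotential (cookieSeq M p p₀) z (fun s => X s ω) t) ∂P := by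
  set q := cookieSeq M p p₀
  set A := {ω | ∀ m : Fin (t + 1), X m ω = w m} with hA
  have hAm : MeasurableSet A := measurableSet_forall_eq hX.measurable w
  rcases A.eq_empty_or_nonempty with hemp | ⟨ω₀, hω₀⟩
  · simp [hemp]
  have hagree : ∀ ω ∈ A, ∀ s ≤ t, X s ω = X s ω₀ := fun ω hω s hs =>
    (hω ⟨s, by omega⟩).trans (hω₀ ⟨s, by omega⟩).symm
  by_cases hhit : ∃ s ≤ t, X s ω₀ = n
  · refine setLIntegral_congr_fun hAm fun ω hω => ?_
    have : ∃ s ≤ t, X s ω = n := by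
      obtain ⟨s, hs, h⟩ := hhit
      exact ⟨s, hs, (hagree ω hω s hs).trans h⟩
    simp only [stoppedPotential_succ_of_exists (x := fun s => X s ω) this]
  push Not at hhit
  set r := stepCount (fun s => X s ω₀) 1 t with hr
  set k := stepCount (fun s => X s ω₀) (-1) t with hk
  set y := X t ω₀
  have hhit' : ∀ ω ∈ A, ∀ s ≤ t, X s ω ≠ n := fun ω hω s hs => by
    rw [hagree ω hω s hs]; exact hhit s hs
  have hrω : ∀ ω ∈ A, stepCount (fun s => X s ω) 1 t = r := fun ω hω =>
    stepCount_congr (hagree ω hω) 1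
  have hkω : ∀ ω ∈ A, stepCount (fun s => X s ω) (-1) t = k := fun ω hω =>
    stepCount_congr (hagree ω hω) (-1)
  have hyω : ∀ ω ∈ A, X t ω = y := fun ω hω => hagree ω hω t le_rfl
  set B := {ω | X (t + 1) ω = y + 1} with hB
  have hBm : MeasurableSet B := hX.measurable (t + 1) (measurableSet_singleton (y + 1))
  have hPAB : P (A ∩ B) = ENNReal.ofReal (q (r y + k y)) * P A := by
    have h := hX.cond t w
    have hwl : w (Fin.last t) = y := (hω₀ (Fin.last t)).symm
    have hcard : (Finset.univ.filter fun m : Fin (t + 1) => w m = w (Fin.last t)).card - 1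
        = r y + k y := by
      rw [hwl, hr, hk, ← card_visits_sub_one (x := fun s => X s ω₀) (hX.steps ω₀) t]
      congr 3
      ext m
      rw [hω₀ m]
    rw [hcard, hwl] at h
    rw [Set.inter_comm]
    exact h
  have hPdiff : P (A \ B) = ENNReal.ofReal (1 - q (r y + k y)) * P A := by
    rw [ENNReal.eq_sub_of_add_eq (measure_ne_top P _) (measure_sdiff_add_inter A hBm), hPAB,
      ENNReal.ofReal_sub _ (hq _).1, ENNReal.ofReal_one,
      ENNReal.sub_mul fun _ _ => measure_ne_top _ _, one_mul]
  rw [← lintegral_inter_add_sdiff _ A hBm]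
  have h1 : ∫⁻ ω in A ∩ B, ENNReal.ofReal (stoppedPotential q z (fun s => X s ω) (t + 1)) ∂P
      = ENNReal.ofReal (countPotential q z (Function.update r y (r y + 1)) k) * P (A ∩ B) := by
    rw [← setLIntegral_const]
    refine setLIntegral_congr_fun (hAm.inter hBm) fun ω hω => ?_
    have hstep : X (t + 1) ω = X t ω + 1 := by rw [hyω ω hω.1]; exact hω.2
    rw [stoppedPotential_of_forall_ne fun s hs => hhit' ω hω.1 s (by omega),
      stepCount_succ_of_eq (x := fun s => X s ω) hstep,
      stepCount_succ_of_ne (x := fun s => X s ω) (d := -1) (by omega),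
      hrω ω hω.1, hkω ω hω.1, hyω ω hω.1]
  have h2 : ∫⁻ ω in A \ B, ENNReal.ofReal (stoppedPotential q z (fun s => X s ω) (t + 1)) ∂P
      = ENNReal.ofReal (countPotential q z r (Function.update k y (k y + 1))) * P (A \ B) := by
    rw [← setLIntegral_const]
    refine setLIntegral_congr_fun (hAm.diff hBm) fun ω hω => ?_
    have hne : X (t + 1) ω ≠ X t ω + 1 := by rw [hyω ω hω.1]; exact hω.2
    have hstep : X (t + 1) ω = X t ω + -1 := by
      rcases (abs_eq zero_le_one).1 (hX.steps ω t) with h | h <;> omega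
    rw [stoppedPotential_of_forall_ne fun s hs => hhit' ω hω.1 s (by omega),
      stepCount_succ_of_eq (x := fun s => X s ω) hstep,
      stepCount_succ_of_ne (x := fun s => X s ω) (d := 1) hne,
      hrω ω hω.1, hkω ω hω.1, hyω ω hω.1]
  have h3 : ∫⁻ ω in A, ENNReal.ofReal (stoppedPotential q z (fun s => X s ω) t) ∂P
      = ENNReal.ofReal (countPotential q z r k) * P A := by
    rw [← setLIntegral_const]
    refine setLIntegral_congr_fun hAm fun ω hω => ?_
    rw [stoppedPotential_of_forall_ne fun s hs => hhit' ω hω s hs.le, hrω ω hω, hkω ω hω]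
  have hharm := countPotential_step q z r k (y := y)
    (forall_lt_of_forall_ne (x := fun s => X s ω₀) (hX.init ω₀) (hX.steps ω₀) hhit)
    (stepCount_eq_zero_of_forall_ne (fun s hs => hhit s hs.le) _)
    (fun hy0 => by
      rw [hr, stepCount_edge (hX.init ω₀) (hX.steps ω₀) hy0, if_neg (lt_irrefl y), add_zero])
  have hq0 := (hq (r y + k y)).1
  have hq1 : 0 ≤ 1 - q (r y + k y) := by linarith [(hq (r y + k y)).2]
  rw [h1, h2, h3, hPAB, hPdiff, hharm,
    ENNReal.ofReal_add (mul_nonneg hq0 (countPotential_mem_Icc hq _ _ _).1)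
      (mul_nonneg hq1 (countPotential_mem_Icc hq _ _ _).1),
    ENNReal.ofReal_mul hq0, ENNReal.ofReal_mul hq1]
  ring

lemma lintegral_stoppedPotential [IsProbabilityMeasure P]
    (hq : ∀ j, cookieSeq M p p₀ j ∈ Set.Icc (0 : ℝ) 1) (hX : IsEARW P M p p₀ X) (t : ℕ) :
    ∫⁻ ω, ENNReal.ofReal (stoppedPotential (cookieSeq M p p₀) z (fun s => X s ω) t) ∂P
      = ENNReal.ofReal (∏ i : Fin n, bbTrans (cookieSeq M p p₀) (z i.castSucc) (z i.succ)) := by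
  induction t with
  | zero => simp [stoppedPotential_zero]
  | succ t ih =>
    rw [← ih]
    have hm : ∀ w : Fin (t + 1) → ℤ, MeasurableSet {ω | ∀ m : Fin (t + 1), X m ω = w m} :=
      measurableSet_forall_eq hX.measurable
    have hd : Pairwise (Function.onFun Disjoint
        fun w : Fin (t + 1) → ℤ => {ω | ∀ m : Fin (t + 1), X m ω = w m}) := by
      intro w w' hww'
      refine Set.disjoint_left.2 fun ω hω hω' => hww' (funext fun m => ?_)
      exact (hω m).symm.trans (hω' m)
    have hu : ⋃ w : Fin (t + 1) → ℤ, {ω | ∀ m : Fin (t + 1), X m ω = w m} = Set.univ :=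
      Set.eq_univ_of_forall fun ω => Set.mem_iUnion.2 ⟨fun m => X m ω, fun _ => rfl⟩
    rw [← setLIntegral_univ, ← setLIntegral_univ (μ := P), ← hu, lintegral_iUnion hm hd,
      lintegral_iUnion hm hd]
    exact tsum_congr fun w => setLIntegral_stoppedPotential_succ hq hX t w

end Martingale

/-- **The backwards branching-like process encodes the left-step counts.**
If the walk is recurrent or transient to the right (`T n < ∞` a.s. for all `n`), then
`(U_n^n, U_{n-1}^n, …, U_0^n)` has the same joint distribution as `(Z 0, Z 1, …, Z n)`,
the backwards branching-like process started at `Z 0 = 0`; the joint law of the latter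
is the product of the transition probabilities `bbTrans`, with the mass of `(z 0 ≠ 0)`
equal to `0`. -/
theorem leftSteps_eq_bb_process_in_distribution
    {Ω : Type*} [MeasurableSpace Ω] (P : Measure Ω) [IsProbabilityMeasure P]
    (M : ℕ) (hM : 1 ≤ M) (p : Fin M → ℝ) (hp : ∀ i, p i ∈ Set.Ioo (0 : ℝ) 1)
    (p₀ : ℝ) (hp₀ : p₀ ∈ Set.Ioo (0 : ℝ) 1)
    (X : ℕ → Ω → ℤ) (hX : IsEARW P M p p₀ X)
    (hhit : ∀ n : ℕ, ∀ᵐ ω ∂P, ∃ t, X t ω = (n : ℤ)) :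
    ∀ (n : ℕ) (z : Fin (n + 1) → ℕ),
      P {ω | ∀ i : Fin (n + 1), leftSteps X ((n : ℤ) - (i : ℕ)) n ω = z i}
        = ENNReal.ofReal
            (if z 0 = 0 then
              ∏ i : Fin n, bbTrans (cookieSeq M p p₀) (z i.castSucc) (z i.succ)
            else 0) := by
  intro n z
  have hq := cookieSeq_mem_Icc hp hp₀
  set E := {ω | ∀ i : Fin (n + 1), leftSteps X ((n : ℤ) - (i : ℕ)) n ω = z i} with hE
  have hleft : ∀ y ω, leftSteps X y n ω
      = stepCount (fun s => X s ω) (-1) (hitTime X n ω) y := fun _ _ => rfl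
  have hlt : ∀ ω, ∀ s < hitTime X n ω, X s ω ≠ n := fun ω s hs => Nat.notMem_of_lt_sInf hs
  split_ifs with hz
  swap
  · rw [ENNReal.ofReal_zero, show E = ∅ from Set.eq_empty_of_forall_notMem fun ω hω => hz ?_,
      measure_empty]
    have h := hω 0
    rw [hleft, Fin.val_zero, Nat.cast_zero, sub_zero,
      stepCount_eq_zero_of_forall_ne (hlt ω)] at h
    exact h.symm
  have hmeas : ∀ t, Measurable fun ω =>
      ENNReal.ofReal (stoppedPotential (cookieSeq M p p₀) z (fun s => X s ω) t) := fun t =>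
    (measurable_stoppedPotential hX.measurable t).ennreal_ofReal
  have hlim : ∀ᵐ ω ∂P, Tendsto (fun t =>
      ENNReal.ofReal (stoppedPotential (cookieSeq M p p₀) z (fun s => X s ω) t)) atTop
      (𝓝 (E.indicator (fun _ => (1 : ENNReal)) ω)) := by
    filter_upwards [hhit n] with ω hω
    have hT : X (hitTime X n ω) ω = n := Nat.sInf_mem hω
    refine tendsto_const_nhds.congr' ?_
    filter_upwards [eventually_ge_atTop (hitTime X n ω)] with t ht
    classical
    rw [stoppedPotential_of_ge (x := fun s => X s ω) hT ht,
      stoppedPotential_of_forall_ne (hlt ω),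
      countPotential_at_hit hz (hX.init ω) (hX.steps ω) hT (hlt ω), Set.indicator_apply]
    simp only [hE, Set.mem_ofPred_eq, hleft]
    split_ifs <;> simp
  have hEm : NullMeasurableSet E P :=
    (aemeasurable_indicator_const_iff (1 : ENNReal)).1
      (aemeasurable_of_tendsto_metrizable_ae atTop (fun t => (hmeas t).aemeasurable) hlim)
  have hconv := tendsto_lintegral_of_dominated_convergence (fun _ => (1 : ENNReal)) hmeas
    (fun t => Eventually.of_forall fun ω =>
      ENNReal.ofReal_le_one.2 (stoppedPotential_mem_Icc hq t).2) (by simp) hlim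
  simp only [lintegral_stoppedPotential hq hX] at hconv
  rw [lintegral_indicator_const₀ hEm, one_mul] at hconv
  exact tendsto_nhds_unique tendsto_const_nhds hconv |>.symm
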